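/- Let f, g : FIN_A ∪ {∅} → C be colorings into a finite set C such that g is strongly proximal to f. Then there exists an infinite block sequence X ⊆ FIN_{A⋆} such that f(p) = g(p) = g(∅) for every p ∈ [X]_A; in particular [X]_A is both f-homogeneous and g-homogeneous for color g(∅). -/

import Mathlib

namespace Carlson

/-- The domain of a partial function `ℕ →. B`, encoded as `ℕ → Option B`. -/
def dom {B : Type*} (p : ℕ → Option B) : Set ℕ := {n | p n ≠ none}

/-- `p` is a located word over `B`: a partial function with finite nonempty domain. -/
def IsLW {B : Type*} (p : ℕ → Option B) : Prop := (dom p).Finite ∧ (dom p).Nonempty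

/-- A located variable word over `A` is a located word over `Option A`
(where `none` encodes the variable `⋆`) taking the value `⋆` at least once. -/
def IsLVW {A : Type*} (p : ℕ → Option (Option A)) : Prop :=
  IsLW p ∧ ∃ n, p n = some none

/-- `p < q`: every element of the domain of `p` is below every element of the domain of `q`. -/
def blt {B : Type*} (p q : ℕ → Option B) : Prop :=
  ∀ m ∈ dom p, ∀ n ∈ dom q, m < n

/-- Union `p ∪ q` of two partial functions (`p` takes precedence; for `blt p q`
the domains are disjoint, so this is the genuine union). -/
def pun {B : Type*} (p q : ℕ → Option B) : ℕ → Option B :=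
  fun n => (p n).elim (q n) some

/-- The empty partial function. -/
def emptyW {B : Type*} : ℕ → Option B := fun _ => none

/-- `p[a]`: substitution of the letter `a ∈ A` for the variable `⋆` in a located
variable word. -/
def substA {A : Type*} (p : ℕ → Option (Option A)) (a : A) : ℕ → Option A :=
  fun n => (p n).map fun x => x.getD a

/-- `p[a]` for `a ∈ A ∪ {⋆}` (with `none` encoding `⋆`, so `p[⋆] = p`). -/
def substV {A : Type*} (p : ℕ → Option (Option A)) (a : Option A) : ℕ → Option (Option A) :=
  fun n => (p n).map fun x => x.elim a some

/-- Union of a finite family of partial functions with pairwise disjoint domains. -/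
def famUnion {B : Type*} {k : ℕ} (g : Fin k → ℕ → Option B) : ℕ → Option B :=
  fun n => ((List.ofFn fun i => g i n).filterMap id).head?

/-- A block sequence: a set of located variable words totally ordered by `<`. -/
def IsBlockSeq {A : Type*} (X : Set (ℕ → Option (Option A))) : Prop :=
  (∀ p ∈ X, IsLVW p) ∧ ∀ p ∈ X, ∀ q ∈ X, p = q ∨ blt p q ∨ blt q p

/-- `[X]_A`: located words of the form `p₀[a₀] ∪ ⋯ ∪ p_k[a_k]` with `p₀ < ⋯ < p_k`
all in `X` and `a₀, …, a_k ∈ A`. -/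
def combA {A : Type*} (X : Set (ℕ → Option (Option A))) : Set (ℕ → Option A) :=
  { q | ∃ (k : ℕ) (p : Fin (k + 1) → ℕ → Option (Option A)) (a : Fin (k + 1) → A),
      (∀ i, p i ∈ X) ∧ (∀ i j : Fin (k + 1), i < j → blt (p i) (p j)) ∧
      q = famUnion fun i => substA (p i) (a i) }

/-- `[X]_{A⋆}`: located variable words of the form `p₀[a₀] ∪ ⋯ ∪ p_k[a_k]` with
`p₀ < ⋯ < p_k` all in `X`, `a₀, …, a_k ∈ A ∪ {⋆}`, and `⋆` used at least once. -/
def combV {A : Type*} (X : Set (ℕ → Option (Option A))) : Set (ℕ → Option (Option A)) :=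
  { q | ∃ (k : ℕ) (p : Fin (k + 1) → ℕ → Option (Option A)) (a : Fin (k + 1) → Option A),
      (∀ i, p i ∈ X) ∧ (∀ i j : Fin (k + 1), i < j → blt (p i) (p j)) ∧
      (∃ i, a i = none) ∧ q = famUnion fun i => substV (p i) (a i) }

/-- `X − F`: the elements of `X` whose domain lies entirely above the domains of
all members of `F`. -/
def sminus {B : Type*} (X F : Set (ℕ → Option B)) : Set (ℕ → Option B) :=
  { q ∈ X | ∀ p ∈ F, blt p q }

/-- `dom q ⊆ [0, ℓ)`. -/
def domBelow {B : Type*} (q : ℕ → Option B) (ℓ : ℕ) : Prop := ∀ n ∈ dom q, n < ℓ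

/-- `dom q ⊆ [m, ∞)`. -/
def domAbove {B : Type*} (q : ℕ → Option B) (m : ℕ) : Prop := ∀ n ∈ dom q, m ≤ n

/-- `S^ℓ_p(f) = S^ℓ_{p'}(g)` for colorings of located words: agreement at `q ∪ p`
vs `q ∪ p'` for every located word `q` with domain contained in `[0, ℓ)`.
(Take `p' = emptyW` to express `S^ℓ_p(f) = S^ℓ(g)`.) -/
def SEq {A C : Type*} (f g : (ℕ → Option A) → C) (ℓ : ℕ) (p p' : ℕ → Option A) : Prop :=
  ∀ q : ℕ → Option A, IsLW q → domBelow q ℓ → f (pun q p) = g (pun q p')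

/-- Variant of `SEq` for colorings that are also defined at the empty located word,
i.e. `q` ranges over `FIN_A(0, ℓ) ∪ {∅}`. -/
def SEq0 {A C : Type*} (f g : (ℕ → Option A) → C) (ℓ : ℕ) (p p' : ℕ → Option A) : Prop :=
  ∀ q : ℕ → Option A, (dom q).Finite → domBelow q ℓ → f (pun q p) = g (pun q p')

/-- A coloring `f` is recurrent if for every `ℓ` there is a located variable word `p`
with domain in `[ℓ, ∞)` such that `S^ℓ_{p[a]}(f) = S^ℓ(f)` for every `a ∈ A`. -/
def Recurrent {A C : Type*} (f : (ℕ → Option A) → C) : Prop :=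
  ∀ ℓ : ℕ, ∃ p : ℕ → Option (Option A), IsLVW p ∧ domAbove p ℓ ∧
    ∀ a : A, SEq f f ℓ (substA p a) emptyW

/-- A coloring `f` is uniformly recurrent if for every `ℓ` there is `m > ℓ` such that
for every `p ∈ FIN_A(m, ∞)` there is `q ∈ FIN_A(ℓ, m)` with `S^ℓ_{q ∪ p}(f) = S^ℓ(f)`. -/
def UnifRecurrent {A C : Type*} (f : (ℕ → Option A) → C) : Prop :=
  ∀ ℓ : ℕ, ∃ m : ℕ, ℓ < m ∧ ∀ p : ℕ → Option A, IsLW p → domAbove p m →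
    ∃ q : ℕ → Option A, IsLW q ∧ domAbove q ℓ ∧ domBelow q m ∧
      SEq f f ℓ (pun q p) emptyW

/-- `f` and `g` are weakly proximal: for every `ℓ` there is `p ∈ FIN_A(ℓ, ∞)` with
`S^ℓ_p(f) = S^ℓ_p(g)`. -/
def WeakProx {A C : Type*} (f g : (ℕ → Option A) → C) : Prop :=
  ∀ ℓ : ℕ, ∃ p : ℕ → Option A, IsLW p ∧ domAbove p ℓ ∧ SEq f g ℓ p p

/-- `g` is strongly proximal to `f`: for every `ℓ` there is a located variable word `p`
with domain in `[ℓ, ∞)` such that `S^ℓ(g) = S^ℓ_{p[a]}(g) = S^ℓ_{p[a]}(f)` for all `a ∈ A`. -/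
def StrongProx {A C : Type*} (g f : (ℕ → Option A) → C) : Prop :=
  ∀ ℓ : ℕ, ∃ p : ℕ → Option (Option A), IsLVW p ∧ domAbove p ℓ ∧
    ∀ a : A, SEq g g ℓ emptyW (substA p a) ∧ SEq g f ℓ (substA p a) (substA p a)

/-- `Recurrent` for colorings also defined at the empty located word. -/
def Recurrent0 {A C : Type*} (f : (ℕ → Option A) → C) : Prop :=
  ∀ ℓ : ℕ, ∃ p : ℕ → Option (Option A), IsLVW p ∧ domAbove p ℓ ∧
    ∀ a : A, SEq0 f f ℓ (substA p a) emptyW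

/-- `StrongProx` for colorings also defined at the empty located word. -/
def StrongProx0 {A C : Type*} (g f : (ℕ → Option A) → C) : Prop :=
  ∀ ℓ : ℕ, ∃ p : ℕ → Option (Option A), IsLVW p ∧ domAbove p ℓ ∧
    ∀ a : A, SEq0 g g ℓ emptyW (substA p a) ∧ SEq0 g f ℓ (substA p a) (substA p a)

/-- Agreement of two colorings on all located words with domain in `[0, ℓ)`. -/
def AgreeBelow {A C : Type*} (f g : (ℕ → Option A) → C) (ℓ : ℕ) : Prop :=
  ∀ q : ℕ → Option A, IsLW q → domBelow q ℓ → f q = g q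

/-- Closedness of a class in `C^{FIN_A}` with the product topology (`C` discrete):
a class is closed iff it contains every coloring all of whose finite restrictions
(to located words with domain in `[0, ℓ)`, for each `ℓ`) are matched within the class. -/
def IsClosedColl {A C : Type*} (𝓒 : Set ((ℕ → Option A) → C)) : Prop :=
  ∀ f, (∀ ℓ : ℕ, ∃ g ∈ 𝓒, AgreeBelow f g ℓ) → f ∈ 𝓒

/-- A subshift: a nonempty closed class `𝓒 ⊆ C^{FIN_A}` such that for every `f ∈ 𝓒`,
`ℓ ∈ ℕ` and `p ∈ FIN_A(ℓ, ∞)` there is `g ∈ 𝓒` with `S^ℓ(g) = S^ℓ_p(f)`. -/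
def IsSubshift {A C : Type*} (𝓒 : Set ((ℕ → Option A) → C)) : Prop :=
  𝓒.Nonempty ∧ IsClosedColl 𝓒 ∧
    ∀ f ∈ 𝓒, ∀ ℓ : ℕ, ∀ p : ℕ → Option A, IsLW p → domAbove p ℓ →
      ∃ g ∈ 𝓒, SEq g f ℓ emptyW p

/-- A minimal subshift: no subshift is a proper subset of it. -/
def IsMinimalSubshift {A C : Type*} (𝓒 : Set ((ℕ → Option A) → C)) : Prop :=
  IsSubshift 𝓒 ∧ ∀ 𝓓 : Set ((ℕ → Option A) → C), IsSubshift 𝓓 → 𝓓 ⊆ 𝓒 → 𝓓 = 𝓒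

/-- The orbit closure of a coloring `f`: all `g` such that for every `ℓ` and every
`q ∈ FIN_A(ℓ, ∞)` there is `p ∈ FIN_A(ℓ, ∞)` with `S^ℓ_q(g) = S^ℓ_p(f)`. -/
def orbCl {A C : Type*} (f : (ℕ → Option A) → C) : Set ((ℕ → Option A) → C) :=
  { g | ∀ ℓ : ℕ, ∀ q : ℕ → Option A, IsLW q → domAbove q ℓ →
      ∃ p : ℕ → Option A, IsLW p ∧ domAbove p ℓ ∧ SEq g f ℓ q p }

/-- A variable word over `A`, encoded as a list over `Option A` with `none` = `⋆`:
the variable must occur at least once. -/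
def IsVarWord {A : Type*} (w : List (Option A)) : Prop := none ∈ w

/-- `w[a]`: replace every occurrence of the variable `⋆` by the letter `a`. -/
def substW {A : Type*} (w : List (Option A)) (a : A) : List A :=
  w.map fun x => x.getD a

/-- `⟨(w_n)_{n∈ℕ}⟩_A`: the words `w_{j₀}[a₀] ⋯ w_{j_{k-1}}[a_{k-1}]` extracted from
the sequence `(w_n)`, for `j₀ < ⋯ < j_{k-1}` and letters `a₀, …, a_{k-1} ∈ A`. -/
def extracted {A : Type*} (w : ℕ → List (Option A)) : Set (List A) :=
  { u | ∃ (k : ℕ) (j : Fin (k + 1) → ℕ) (a : Fin (k + 1) → A),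
      StrictMono j ∧ u = (List.ofFn fun i => substW (w (j i)) (a i)).flatten }

theorem famUnion_succ {B : Type*} {k : ℕ} (g : Fin (k + 1) → ℕ → Option B) :
    famUnion g = pun (famUnion fun i : Fin k => g i.castSucc) (g (Fin.last k)) := by
  funext n
  simp only [famUnion, pun, List.ofFn_succ', List.concat_eq_append, List.filterMap_append,
    List.head?_append]
  cases ((List.ofFn fun i : Fin k => g i.castSucc n).filterMap id).head? <;>
    cases g (Fin.last k) n <;> simp

theorem dom_famUnion_subset {B : Type*} {k : ℕ} (g : Fin k → ℕ → Option B) :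
    dom (famUnion g) ⊆ ⋃ i, dom (g i) := by
  intro n hn
  by_contra hc
  simp only [Set.mem_iUnion, not_exists, dom, Set.mem_ofPred_eq, not_not] at hc
  exact hn (by simp [famUnion, hc])

theorem dom_substA {A : Type*} (p : ℕ → Option (Option A)) (a : A) :
    dom (substA p a) = dom p := by
  ext n
  simp [dom, substA]

theorem pun_emptyW {B : Type*} (p : ℕ → Option B) : pun p emptyW = p := by
  funext n
  cases h : p n <;> simp [pun, emptyW, h]

/-- A strongly proximal pair admits variable words `x n` supported in consecutive intervals
`[s n, s (n + 1))`, each witnessing strong proximality at level `s n`. -/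
theorem StrongProx0.exists_seq {A C : Type*} {f g : (ℕ → Option A) → C} (h : StrongProx0 g f) :
    ∃ (s : ℕ → ℕ) (x : ℕ → ℕ → Option (Option A)), StrictMono s ∧
      ∀ n, IsLVW (x n) ∧ domAbove (x n) (s n) ∧ domBelow (x n) (s (n + 1)) ∧
        ∀ a : A, SEq0 g g (s n) emptyW (substA (x n) a) ∧
          SEq0 g f (s n) (substA (x n) a) (substA (x n) a) := by
  choose P hP hab hS using h
  have hM : ∀ l, ∃ m, l < m ∧ domBelow (P l) m := by
    intro l
    obtain ⟨b, hb⟩ := (hP l).1.1.bddAbove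
    exact ⟨max l b + 1, by omega, fun n hn => by have := hb hn; omega⟩
  choose M hlM hM using hM
  let s : ℕ → ℕ := fun n => M^[n] 0
  have hs : ∀ n, s (n + 1) = M (s n) := fun n => Function.iterate_succ_apply' M n 0
  refine ⟨s, fun n => P (s n), strictMono_nat_of_lt_succ fun n => ?_, fun n =>
    ⟨hP _, hab _, ?_, hS _⟩⟩
  · rw [hs]; exact hlM _
  · rw [hs]; exact hM _

/-- If `g` is strongly proximal to `f` (colorings defined also at the empty located
word), then there is an infinite block sequence `X ⊆ FIN_{A⋆}` such that `[X]_A` is both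
`f`-homogeneous and `g`-homogeneous for color `g(∅)`. -/
theorem strongProx_yields_homogeneous {A C : Type*} [Fintype A] [Nonempty A] [Fintype C]
    (f g : (ℕ → Option A) → C) (h : StrongProx0 g f) :
    ∃ X : Set (ℕ → Option (Option A)), IsBlockSeq X ∧ X.Infinite ∧
      ∀ q ∈ combA X, f q = g emptyW ∧ g q = g emptyW := by
  obtain ⟨s, x, hs, hx⟩ := h.exists_seq
  have hlt : ∀ i j, i < j → blt (x i) (x j) := fun i j hij m hm n hn =>
    ((hx i).2.2.1 m hm).trans_le ((hs.monotone hij).trans ((hx j).2.1 n hn))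
  have hblt : ∀ i j, blt (x i) (x j) → i < j := by
    intro i j hb
    by_contra! hji
    obtain ⟨m, hm⟩ := (hx i).1.1.2
    obtain ⟨n, hn⟩ := (hx j).1.1.2
    rcases hji.eq_or_lt with rfl | hji
    · exact (hb m hm m hm).false
    · exact (hb m hm n hn).asymm (hlt j i hji n hn m hm)
  have hinj : Function.Injective x := by
    intro i j hij
    obtain ⟨m, hm⟩ := (hx i).1.1.2
    rcases lt_trichotomy i j with hl | hl | hl
    · exact absurd (hlt i j hl m hm m (hij ▸ hm)) (lt_irrefl m)
    · exact hl
    · exact absurd (hlt j i hl m (hij ▸ hm) m hm) (lt_irrefl m)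
  have step : ∀ (k : ℕ) (p : Fin (k + 1) → ℕ → Option (Option A)) (a : Fin (k + 1) → A),
      (∀ i, p i ∈ Set.range x) → (∀ i j : Fin (k + 1), i < j → blt (p i) (p j)) →
      g (famUnion fun i => substA (p i) (a i)) =
          g (famUnion fun i : Fin k => substA (p i.castSucc) (a i.castSucc)) ∧
        f (famUnion fun i => substA (p i) (a i)) =
          g (famUnion fun i => substA (p i) (a i)) := by
    intro k p a hp hpp
    obtain ⟨m, hm⟩ := hp (Fin.last k)
    have hsub := dom_famUnion_subset fun i : Fin k => substA (p i.castSucc) (a i.castSucc)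
    simp only [dom_substA] at hsub
    have hfin : (dom (famUnion fun i : Fin k =>
        substA (p i.castSucc) (a i.castSucc))).Finite := by
      refine (Set.finite_iUnion fun i => ?_).subset hsub
      obtain ⟨j, hj⟩ := hp i.castSucc
      exact hj ▸ (hx j).1.1.1
    have hbelow : domBelow (famUnion fun i : Fin k =>
        substA (p i.castSucc) (a i.castSucc)) (s m) := by
      intro n hn
      obtain ⟨i, hi⟩ := Set.mem_iUnion.1 (hsub hn)
      obtain ⟨j, hj⟩ := hp i.castSucc
      have hb := hpp i.castSucc (Fin.last k) (Fin.castSucc_lt_last i)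
      rw [← hj, ← hm] at hb
      rw [← hj] at hi
      exact ((hx j).2.2.1 n hi).trans_le (hs.monotone (hblt j m hb))
    obtain ⟨h1, h2⟩ := (hx m).2.2.2 (a (Fin.last k))
    have h1 := h1 _ hfin hbelow
    have h2 := h2 _ hfin hbelow
    rw [pun_emptyW] at h1
    rw [famUnion_succ, ← hm]
    exact ⟨h1.symm, h2.symm⟩
  have hg : ∀ (k : ℕ) (p : Fin k → ℕ → Option (Option A)) (a : Fin k → A),
      (∀ i, p i ∈ Set.range x) → (∀ i j : Fin k, i < j → blt (p i) (p j)) →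
      g (famUnion fun i => substA (p i) (a i)) = g emptyW := by
    intro k
    induction k with
    | zero => intro p a _ _; rfl
    | succ k ih =>
      intro p a hp hpp
      rw [(step k p a hp hpp).1]
      exact ih (fun i => p i.castSucc) (fun i => a i.castSucc) (fun i => hp _)
        fun i j hij => hpp _ _ (Fin.castSucc_lt_castSucc_iff.2 hij)
  refine ⟨Set.range x, ⟨?_, ?_⟩, Set.infinite_range_of_injective hinj, ?_⟩
  · rintro _ ⟨n, rfl⟩
    exact (hx n).1
  · rintro _ ⟨i, rfl⟩ _ ⟨j, rfl⟩
    rcases lt_trichotomy i j with hl | rfl | hl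
    · exact Or.inr (Or.inl (hlt i j hl))
    · exact Or.inl rfl
    · exact Or.inr (Or.inr (hlt j i hl))
  · rintro _ ⟨k, p, a, hp, hpp, rfl⟩
    have := hg (k + 1) p a hp hpp
    exact ⟨(step k p a hp hpp).2.trans this, this⟩

end Carlson
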